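/- arXiv:2406.00753 — 2 statements merged into one kernel-verified Lean document; each statement's English description precedes it below -/
import Mathlib

section
/- Suppose Assumptions 1 and 2 hold, and additionally: g_s and γ_s are globally Lipschitz; α_f is of class K∞ and its inverse α_f⁻¹ is globally Lipschitz; α̲_s and α̲_f are square functions (α̲_s(r) = a_s r² and α̲_f(r) = a_f r² for some constants a_s, a_f > 0); and λ_f1 and λ_f2 are square-root functions (λ_f1(r) = b₁√r and λ_f2(r) = b₂√r for some constants b₁, b₂ > 0). Then there exist positive constants c_s and c_f such that, with ρ_s ≡ c_s and ρ_f ≡ c_f, the system ẋ = ρ_s g_s(x,z,d), ż = ρ_f g_f(z,x,w) is ISS with (x, z−φ(0)) as the state and (d,w) as the input. -/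
open Set Filter MeasureTheory InnerProductSpace

noncomputable section

/-- Class `K` functions: continuous on `[0,∞)`, strictly increasing, zero at zero. -/
def ClassK (α : ℝ → ℝ) : Prop :=
  ContinuousOn α (Ici 0) ∧ StrictMonoOn α (Ici 0) ∧ α 0 = 0

/-- Class `K∞` functions: class `K` and unbounded. -/
def ClassKInf (α : ℝ → ℝ) : Prop :=
  ClassK α ∧ ∀ M : ℝ, ∃ r ∈ Ici (0:ℝ), M < α r

/-- Class `P` functions: continuous, positive for positive arguments, nonnegative at zero. -/
def ClassP (α : ℝ → ℝ) : Prop :=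
  ContinuousOn α (Ici 0) ∧ (∀ r > 0, 0 < α r) ∧ 0 ≤ α 0

/-- Class `PD` (positive definite) functions: continuous, positive for positive
arguments, zero at zero. -/
def ClassPD (α : ℝ → ℝ) : Prop :=
  ContinuousOn α (Ici 0) ∧ (∀ r > 0, 0 < α r) ∧ α 0 = 0

/-- Class `KL` functions. -/
def ClassKL (β : ℝ → ℝ → ℝ) : Prop :=
  ContinuousOn (Function.uncurry β) (Ici 0 ×ˢ Ici 0) ∧
  (∀ t ≥ 0, ClassK (fun s => β s t)) ∧
  (∀ s > 0, AntitoneOn (fun t => β s t) (Ici 0) ∧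
    Tendsto (fun t => β s t) atTop (nhds 0))

/-- One-sided mean value inequality on `[0, τ]`. -/
theorem aux_mvt {g g' : ℝ → ℝ} {τ c : ℝ}
    (hg : ∀ t ∈ Icc (0:ℝ) τ, HasDerivWithinAt g (g' t) (Icc 0 τ) t)
    (hc : ∀ t ∈ Icc (0:ℝ) τ, g' t ≤ c) : ∀ t ∈ Icc (0:ℝ) τ, g t ≤ g 0 + c * t := by
  intro t ht
  refine image_le_of_deriv_right_le_deriv_boundary (f := g) (f' := g') (a := 0) (b := τ)
    (B := fun t => g 0 + c * t) (B' := fun _ => c)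
    (fun x hx => (hg x hx).continuousWithinAt) (fun x hx => ?_) (by simp) (by fun_prop)
    (fun x hx => ?_) (fun x hx => hc x (Ico_subset_Icc_self hx)) ht
  · exact (hg x <| Ico_subset_Icc_self hx).mono_of_mem_nhdsWithin (Icc_mem_nhdsGE_of_mem hx)
  · simpa using (((hasDerivAt_id x).const_mul c).const_add (g 0)).hasDerivWithinAt

/-- Existence of solutions for a bounded locally Lipschitz vector field. -/
theorem aux_flow {n : ℕ} (F : EuclideanSpace ℝ (Fin n) → EuclideanSpace ℝ (Fin n))
    (hF : LocallyLipschitz F) (M : ℝ) (hM0 : 0 ≤ M) (hM : ∀ x, ‖F x‖ ≤ M)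
    (x0 : EuclideanSpace ℝ (Fin n)) (τ : ℝ) (hτ : 0 < τ) :
    ∃ y : ℝ → EuclideanSpace ℝ (Fin n), y 0 = x0 ∧
      ∀ t ∈ Icc (0:ℝ) τ, HasDerivWithinAt y (F (y t)) (Icc 0 τ) t := by
  have hMτ : 0 ≤ M * τ := by positivity
  obtain ⟨K, hK⟩ := (hF.locallyLipschitzOn (s := Metric.closedBall x0 (M * τ))).exists_lipschitzOnWith_of_compact
    (isCompact_closedBall x0 (M * τ))
  have hPL : IsPicardLindelof (fun _ x => F x) (tmin := 0) (tmax := τ) ⟨0, by simp [hτ.le]⟩ x0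
      ⟨M * τ, hMτ⟩ 0 ⟨M, hM0⟩ K := by
    refine ⟨fun t _ => hK, fun x _ => continuousOn_const, fun t _ x _ => hM x, ?_⟩
    simp only [sub_zero, sub_self, max_eq_left hτ.le, NNReal.coe_zero]
    exact le_rfl
  obtain ⟨y, hy0, hy⟩ := hPL.exists_eq_forall_mem_Icc_hasDerivWithinAt₀
  exact ⟨y, hy0, hy⟩

theorem aux_trunc {E : Type*} [NormedAddCommGroup E] [InnerProductSpace ℝ E] (v : ℝ) (hv : 0 < v) :
    ContDiff ℝ 1 (fun y : E => (1 + ‖y‖ ^ 2 / v ^ 2)⁻¹ • y) := by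
  refine ContDiff.smul (ContDiff.inv ?_ ?_) contDiff_id
  · exact contDiff_const.add ((contDiff_norm_sq ℝ).div_const _)
  · intro x; positivity

set_option maxHeartbeats 1000000 in
/-- The key estimate: the reduced slow vector field is bounded by `C √Vs`. -/
theorem aux_key {n m : ℕ} (f : EuclideanSpace ℝ (Fin n) → EuclideanSpace ℝ (Fin n))
    (φ : EuclideanSpace ℝ (Fin n) → EuclideanSpace ℝ (Fin m))
    (Vs : EuclideanSpace ℝ (Fin n) → ℝ)
    (Vf : EuclideanSpace ℝ (Fin m) → EuclideanSpace ℝ (Fin n) → ℝ)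
    (aS aF b1 b2 L : ℝ) (haS : 0 < aS) (haF : 0 < aF) (hb1 : 0 < b1) (hb2 : 0 < b2) (hL : 0 ≤ L)
    (hf : LocallyLipschitz f)
    (hfφ : ∀ x y, ‖f x - f y‖ ≤ L * (‖x - y‖ + ‖φ x - φ y‖))
    (hVs : Differentiable ℝ Vs) (hVf : ∀ z, Differentiable ℝ (Vf z))
    (hVsb : ∀ x, aS * ‖x‖ ^ 2 ≤ Vs x) (hVsd : ∀ x, fderiv ℝ Vs x (f x) ≤ 0)
    (hVfb : ∀ z x, aF * ‖z - φ x‖ ^ 2 ≤ Vf z x) (hVf0 : ∀ x, Vf (φ x) x = 0)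
    (hcross : ∀ z x, ‖fderiv ℝ (Vf z) x‖ ≤ b1 * √(Vf z x) + b2 * √(Vs x)) :
    ∃ C : ℝ, 0 ≤ C ∧ ∀ x, ‖f x‖ ≤ C * √(Vs x) := by
  set A : ℝ := (√aF)⁻¹ with hA
  set S : ℝ := √aS with hS
  have hA0 : 0 < A := by positivity
  have hS0 : 0 < S := by positivity
  set B : ℝ := (b1 + b2) / 2 with hB
  have hB0 : 0 < B := by positivity
  set τ : ℝ := 1 / (4 * (L + L * B * A + 1)) with hτd
  have hτ : 0 < τ := by positivity
  have hτ1 : L * τ * (1 + B * A) ≤ 1 / 4 := by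
    rw [hτd]
    rw [show L * (1 / (4 * (L + L * B * A + 1))) * (1 + B * A) =
      (L + L * B * A) / (4 * (L + L * B * A + 1)) by field_simp]
    rw [div_le_div_iff₀ (by positivity) (by norm_num)]
    nlinarith [mul_nonneg (mul_nonneg hL hB0.le) hA0.le]
  set ε : ℝ := min (1 / (4 * (L * A + 1))) (τ * S / 20) with hε
  have hε0 : 0 < ε := by positivity
  have hε1 : L * A * ε ≤ 1 / 4 := by
    have h1 : ε ≤ 1 / (4 * (L * A + 1)) := min_le_left _ _
    have h2 : L * A * ε ≤ L * A * (1 / (4 * (L * A + 1))) := by gcongr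
    refine h2.trans ?_
    rw [mul_one_div, div_le_div_iff₀ (by positivity) (by norm_num)]
    nlinarith [mul_nonneg hL hA0.le]
  have hε2 : ε ≤ τ * S / 20 := min_le_right _ _
  refine ⟨1 / ε, by positivity, fun x0 => ?_⟩
  by_contra hcon
  push Not at hcon
  set v : ℝ := ‖f x0‖ with hv
  have hVs0 : ∀ x, 0 ≤ Vs x := fun x => le_trans (by positivity) (hVsb x)
  have hv0 : 0 < v := lt_of_le_of_lt (by positivity) hcon
  set R : ℝ := ε * v with hR
  have hR0 : 0 < R := by positivity
  have hVsR : √(Vs x0) < R := by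
    rw [hR]; rw [one_div, inv_mul_lt_iff₀ hε0] at hcon; exact hcon
  set F : EuclideanSpace ℝ (Fin n) → EuclideanSpace ℝ (Fin n) :=
    fun x => (1 + ‖f x‖ ^ 2 / v ^ 2)⁻¹ • f x with hF
  have hFl : LocallyLipschitz F :=
    ((aux_trunc (E := EuclideanSpace ℝ (Fin n)) v hv0).locallyLipschitz).comp hf
  have hFb : ∀ x, ‖F x‖ ≤ v := by
    intro x
    rw [hF]
    simp only
    rw [norm_smul, Real.norm_of_nonneg (by positivity), inv_mul_le_iff₀ (by positivity)]
    have : (1 + ‖f x‖ ^ 2 / v ^ 2) * v = v + ‖f x‖ ^ 2 / v := by field_simp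
    rw [this]
    have : ‖f x‖ - v ≤ ‖f x‖ ^ 2 / v := by
      rw [le_div_iff₀ hv0]; nlinarith [sq_nonneg (‖f x‖ - v), norm_nonneg (f x)]
    linarith
  obtain ⟨y, hy0, hy⟩ := aux_flow F hFl v hv0.le hFb x0 τ hτ
  -- Vs decreases
  have hVy : ∀ t ∈ Icc (0:ℝ) τ, Vs (y t) ≤ Vs x0 := by
    intro t ht
    have := aux_mvt (g := fun t => Vs (y t)) (g' := fun t => fderiv ℝ Vs (y t) (F (y t)))
      (τ := τ) (c := 0)
      (fun t ht => (hVs (y t)).hasFDerivAt.comp_hasDerivWithinAt t (hy t ht))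
      (fun t ht => by
        simp only [hF, map_smul, smul_eq_mul]
        exact mul_nonpos_of_nonneg_of_nonpos (by positivity) (hVsd _)) t ht
    simpa [hy0] using this
  have hVyR : ∀ t ∈ Icc (0:ℝ) τ, √(Vs (y t)) ≤ R := fun t ht =>
    (Real.sqrt_le_sqrt (hVy t ht)).trans hVsR.le
  have hyn : ∀ t ∈ Icc (0:ℝ) τ, ‖y t - x0‖ ≤ v * t := by
    intro t ht
    have := norm_image_sub_le_of_norm_deriv_le_segment' hy (fun x _ => hFb _) t ht
    simpa [hy0] using this
  have hVf_nn : ∀ z x, 0 ≤ Vf z x := fun z x => le_trans (by positivity) (hVfb z x)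
  -- path estimate for φ
  have hu : ∀ t ∈ Icc (0:ℝ) τ, √(Vf (φ x0) (y t) + R ^ 2) ≤ R + B * v * t := by
    intro t ht
    have hpos : ∀ t, 0 < Vf (φ x0) (y t) + R ^ 2 := fun t => by
      have := hVf_nn (φ x0) (y t); positivity
    have := aux_mvt (g := fun t => √(Vf (φ x0) (y t) + R ^ 2))
      (g' := fun t => (fderiv ℝ (Vf (φ x0)) (y t) (F (y t))) / (2 * √(Vf (φ x0) (y t) + R ^ 2)))
      (τ := τ) (c := B * v)
      (fun t ht => HasDerivWithinAt.sqrt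
        (((hVf (φ x0) (y t)).hasFDerivAt.comp_hasDerivWithinAt t (hy t ht)).add_const _)
          (hpos t).ne')
      (fun t ht => by
        set u := √(Vf (φ x0) (y t) + R ^ 2) with hud
        have hu0 : 0 < u := Real.sqrt_pos.2 (hpos t)
        have h1 : √(Vf (φ x0) (y t)) ≤ u := Real.sqrt_le_sqrt (by nlinarith)
        have h2 : R ≤ u := Real.le_sqrt_of_sq_le (by have := hVf_nn (φ x0) (y t); linarith)
        have h3 := hcross (φ x0) (y t)
        have h4 : fderiv ℝ (Vf (φ x0)) (y t) (F (y t)) ≤ ‖fderiv ℝ (Vf (φ x0)) (y t)‖ * v :=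
          (le_abs_self _).trans (((fderiv ℝ (Vf (φ x0)) (y t)).le_opNorm _).trans
            (by gcongr; exact hFb _))
        have h5 : ‖fderiv ℝ (Vf (φ x0)) (y t)‖ ≤ (b1 + b2) * u := by
          have := hVyR t ht
          have e1 : b1 * √(Vf (φ x0) (y t)) ≤ b1 * u := by gcongr
          have e2 : b2 * √(Vs (y t)) ≤ b2 * u := by gcongr; linarith
          linarith
        rw [div_le_iff₀ (by positivity)]
        calc _ ≤ _ := h4
          _ ≤ (b1 + b2) * u * v := by gcongr
          _ = B * v * (2 * u) := by rw [hB]; ring) t ht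
    simp only [hy0, hVf0, zero_add, Real.sqrt_sq hR0.le] at this
    exact this
  have hφy : ∀ t ∈ Icc (0:ℝ) τ, ‖φ (y t) - φ x0‖ ≤ A * (R + B * v * τ) := by
    intro t ht
    have h1 := hu t ht
    have h2 : √aF * ‖φ x0 - φ (y t)‖ ≤ √(Vf (φ x0) (y t) + R ^ 2) := by
      apply Real.le_sqrt_of_sq_le
      rw [mul_pow, Real.sq_sqrt haF.le]
      have := hVfb (φ x0) (y t)
      nlinarith
    have h3 : B * v * t ≤ B * v * τ := by gcongr; exact ht.2
    rw [norm_sub_rev, hA, ← div_eq_inv_mul, le_div_iff₀ (by positivity), mul_comm]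
    linarith
  have hff : ∀ t ∈ Icc (0:ℝ) τ, ‖f (y t) - f x0‖ ≤ v / 2 := by
    intro t ht
    have h1 : ‖y t - x0‖ ≤ v * τ := (hyn t ht).trans (by gcongr; exact ht.2)
    calc _ ≤ _ := hfφ (y t) x0
      _ ≤ L * (v * τ + A * (R + B * v * τ)) := by gcongr; exact hφy t ht
      _ = (L * τ * (1 + B * A) + L * A * ε) * v := by rw [hR]; ring
      _ ≤ (1 / 4 + 1 / 4) * v := by gcongr
      _ = v / 2 := by ring
  -- displacement in the direction f x0
  have hin : ∀ t ∈ Icc (0:ℝ) τ, 3 / 20 * v ^ 2 ≤ inner ℝ (f x0) (F (y t)) := by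
    intro t ht
    have h1 := hff t ht
    have h2 : ‖f (y t)‖ ≤ 3 / 2 * v := by
      have := norm_sub_norm_le (f (y t)) (f x0)
      linarith
    have h3 : v ^ 2 / 2 ≤ inner ℝ (f x0) (f (y t)) := by
      have e1 : inner ℝ (f x0) (f (y t)) = v ^ 2 + inner ℝ (f x0) (f (y t) - f x0) := by
        rw [inner_sub_right, real_inner_self_eq_norm_sq]; ring
      have e2 := abs_real_inner_le_norm (f x0) (f (y t) - f x0)
      have e3 : ‖f x0‖ * ‖f (y t) - f x0‖ ≤ v * (v / 2) := by gcongr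
      have := neg_abs_le (inner ℝ (f x0) (f (y t) - f x0))
      nlinarith
    simp only [hF, inner_smul_right]
    have h4 : (4 / 13 : ℝ) ≤ (1 + ‖f (y t)‖ ^ 2 / v ^ 2)⁻¹ := by
      rw [show (4 / 13 : ℝ) = (13 / 4 : ℝ)⁻¹ by norm_num]
      apply inv_anti₀ (by positivity)
      have : ‖f (y t)‖ ^ 2 / v ^ 2 ≤ 9 / 4 := by
        rw [div_le_iff₀ (by positivity)]
        nlinarith [norm_nonneg (f (y t))]
      linarith
    calc 3 / 20 * v ^ 2 ≤ 4 / 13 * (v ^ 2 / 2) := by nlinarith [sq_nonneg v]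
      _ ≤ _ := by gcongr
  have hτm : τ ∈ Icc (0:ℝ) τ := ⟨hτ.le, le_rfl⟩
  have hdisp : 3 / 20 * v ^ 2 * τ ≤ inner ℝ (f x0) (y τ - x0) := by
    have := aux_mvt (g := fun t => - inner ℝ (f x0) (y t)) (g' := fun t => - inner ℝ (f x0) (F (y t)))
      (τ := τ) (c := -(3 / 20 * v ^ 2))
      (fun t ht => by
        have := ((innerSL ℝ (f x0)).hasFDerivAt (x := y t)).comp_hasDerivWithinAt t (hy t ht)
        exact this.neg)
      (fun t ht => by have := hin t ht; linarith) τ hτm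
    simp only [hy0] at this
    rw [inner_sub_right]
    linarith
  have hdisp2 : 3 / 20 * v * τ ≤ ‖y τ - x0‖ := by
    have := (hdisp.trans (le_abs_self _)).trans (abs_real_inner_le_norm (f x0) (y τ - x0))
    have h : v * (3 / 20 * v * τ) ≤ v * ‖y τ - x0‖ := by rw [← hv] at this; linarith
    exact le_of_mul_le_mul_left h hv0
  have hnb : ∀ x, √(Vs x) ≤ R → ‖x‖ ≤ R / S := by
    intro x hx
    rw [le_div_iff₀ hS0]
    refine le_trans (Real.le_sqrt_of_sq_le ?_) hx
    rw [mul_pow, hS, Real.sq_sqrt haS.le]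
    linarith [hVsb x]
  have h1 := hnb _ (hVyR τ hτm)
  have h2 := hnb _ hVsR.le
  have h3 : R / S ≤ v * τ / 20 := by
    rw [div_le_iff₀ hS0, hR]
    nlinarith
  have h4 := norm_sub_le (y τ) x0
  have : 0 < v * τ := by positivity
  linarith

theorem aux_dini {V1 V2 : ℝ → ℝ} {v1 v2 t m r : ℝ} (h1 : HasDerivAt V1 v1 t)
    (h2 : HasDerivAt V2 v2 t) (hm1 : V2 t ≤ V1 t → v1 ≤ m) (hm2 : V1 t ≤ V2 t → v2 ≤ m)
    (hr : m < r) : ∃ᶠ z in nhdsWithin t (Ioi t), slope (fun s => max (V1 s) (V2 s)) t z < r := by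
  have key : ∀ {V W : ℝ → ℝ} {v : ℝ}, HasDerivAt V v t → (W t ≤ V t → v ≤ m) →
      ∀ᶠ z in nhdsWithin t (Ioi t), V z < max (V t) (W t) + r * (z - t) := by
    intro V W v h hm
    rcases le_or_gt (W t) (V t) with hle | hlt
    · have := (h.hasDerivWithinAt (s := Ioi t)).limsup_slope_le' (lt_irrefl t)
        (lt_of_le_of_lt (hm hle) hr)
      filter_upwards [this, self_mem_nhdsWithin] with z hz hzt
      rw [slope_def_field, div_lt_iff₀ (sub_pos.2 hzt)] at hz
      rw [max_eq_left hle]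
      linarith
    · rw [max_eq_right hlt.le]
      have c1 : ContinuousAt (fun z => W t + r * (z - t) - V z) t := by
        have := h.continuousAt
        fun_prop
      have : ∀ᶠ z in nhds t, 0 < W t + r * (z - t) - V z :=
        c1.eventually_const_lt (by simpa using hlt)
      filter_upwards [nhdsWithin_le_nhds this] with z hz
      linarith
  have e1 := key h1 hm1
  have e2 := key h2 hm2
  rw [max_comm] at e2
  apply Eventually.frequently
  filter_upwards [e1, e2, self_mem_nhdsWithin] with z hz1 hz2 hzt
  rw [slope_def_field, div_lt_iff₀ (sub_pos.2 hzt)]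
  have := max_lt hz1 hz2
  linarith

set_option maxHeartbeats 1000000 in
theorem aux_KL (α : ℝ → ℝ) (hα : ContinuousOn α (Ici 0)) (hpos : ∀ r > 0, 0 < α r) :
    ∃ β : ℝ → ℝ → ℝ, ClassKL β ∧ ∀ (V1 V2 V1' V2' : ℝ → ℝ) (X : ℝ), 0 ≤ X →
      (∀ t ≥ 0, HasDerivAt V1 (V1' t) t) → (∀ t ≥ 0, HasDerivAt V2 (V2' t) t) →
      (∀ t ≥ 0, V2 t ≤ V1 t → X ≤ V1 t → V1' t ≤ -min (α (V1 t)) (V1 t)) →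
      (∀ t ≥ 0, V1 t ≤ V2 t → X ≤ V2 t → V2' t ≤ -min (α (V2 t)) (V2 t)) →
      ∀ t ≥ 0, max (V1 t) (V2 t) ≤ max (β (max (V1 0) (V2 0)) t) X := by
  set a : ℝ → ℝ := fun r => min (α r) r with ha
  have hapos : ∀ r > 0, 0 < a r := fun r hr => lt_min (hpos r hr) hr
  have hac : ContinuousOn a (Ici 0) := hα.inf continuousOn_id
  set q : ℝ → ℝ := fun y => Real.exp y / a (Real.exp y) with hq
  have hqpos : ∀ y, 0 < q y := fun y => div_pos (Real.exp_pos y) (hapos _ (Real.exp_pos y))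
  have hq1 : ∀ y, 1 ≤ q y := fun y => by
    rw [hq]; simp only
    rw [one_le_div (hapos _ (Real.exp_pos y))]
    exact min_le_right _ _
  have hqc : Continuous q := by
    refine Continuous.div Real.continuous_exp ?_ (fun y => (hapos _ (Real.exp_pos y)).ne')
    exact hac.comp_continuous Real.continuous_exp (fun y => (Real.exp_pos y).le)
  set G : ℝ → ℝ := fun y => ∫ s in (0:ℝ)..y, q s with hG
  have hGd : ∀ y, HasDerivAt G (q y) y := fun y =>
    intervalIntegral.integral_hasDerivAt_right (hqc.intervalIntegrable _ _)
      (hqc.stronglyMeasurableAtFilter _ _) hqc.continuousAt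
  have hGc : Continuous G := continuous_iff_continuousAt.2 fun y => (hGd y).continuousAt
  have hGm : StrictMono G := strictMono_of_deriv_pos fun y => by
    rw [(hGd y).deriv]; exact hqpos y
  have hG0 : G 0 = 0 := by simp [hG]
  have hGsub : Monotone (fun y => G y - y) := by
    apply monotone_of_deriv_nonneg
    · intro y; exact ((hGd y).sub (hasDerivAt_id y)).differentiableAt
    · intro y
      have := ((hGd y).sub (hasDerivAt_id y)).deriv
      have h2 : deriv (fun y => G y - y) y = q y - 1 := this
      rw [h2]
      linarith [hq1 y]
  have hGtop : Tendsto G atTop atTop := by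
    refine tendsto_atTop_mono' _ ?_ tendsto_id
    filter_upwards [eventually_ge_atTop 0] with y hy
    have := hGsub hy
    simp only [hG0] at this
    simp only [id]; linarith
  have hGbot : Tendsto G atBot atBot := by
    refine tendsto_atBot_mono' _ ?_ tendsto_id
    filter_upwards [eventually_le_atBot 0] with y hy
    have := hGsub hy
    simp only [hG0] at this
    simp only [id]; linarith
  have hGs : Function.Surjective G := hGc.surjective hGtop hGbot
  set e : ℝ ≃o ℝ := hGm.orderIsoOfSurjective G hGs with he
  have heG : ∀ y, e y = G y := fun y => rfl
  have hesG : ∀ y, e.symm (G y) = y := fun y => by rw [← heG]; simp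
  have hGes : ∀ y, G (e.symm y) = y := fun y => by rw [← heG]; simp
  have hesc : Continuous e.symm := e.symm.continuous
  have hesd : ∀ y, HasDerivAt e.symm (q (e.symm y))⁻¹ y := fun y =>
    HasDerivAt.of_local_left_inverse hesc.continuousAt (hGd _) (hqpos _).ne'
      (Eventually.of_forall hGes)
  set β : ℝ → ℝ → ℝ := fun s t =>
    if s ≤ 0 then 0 else Real.exp (e.symm (G (Real.log s) - t)) with hβ
  have hβ0 : ∀ t, β 0 t = 0 := fun t => by simp [hβ]
  have hβp : ∀ s > 0, ∀ t, β s t = Real.exp (e.symm (G (Real.log s) - t)) := fun s hs t => by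
    simp [hβ, not_le.2 hs]
  have hβnn : ∀ s t, 0 ≤ β s t := fun s t => by
    simp only [hβ]; split_ifs
    · exact le_rfl
    · positivity
  have hβle : ∀ s ≥ 0, ∀ t ≥ 0, β s t ≤ s := by
    intro s hs t ht
    rcases hs.eq_or_lt with h | h
    · rw [← h, hβ0]
    · rw [hβp s h]
      calc _ ≤ Real.exp (e.symm (G (Real.log s))) := by
            apply Real.exp_le_exp.2; apply e.symm.monotone; linarith
        _ = s := by rw [hesG, Real.exp_log h]
  have hβc : ContinuousOn (Function.uncurry β) (Ici 0 ×ˢ Ici 0) := by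
    rintro ⟨s, t⟩ ⟨hs, ht⟩
    rcases (show (0:ℝ) ≤ s from hs).eq_or_lt with h | h
    · subst h
      rw [ContinuousWithinAt]
      simp only [Function.uncurry, hβ0]
      refine tendsto_of_tendsto_of_tendsto_of_le_of_le' tendsto_const_nhds
        (h := fun p : ℝ × ℝ => p.1) ?_ (Eventually.of_forall fun p => hβnn _ _) ?_
      · have : Tendsto (fun p : ℝ × ℝ => p.1) (nhds ((0:ℝ), t)) (nhds 0) :=
          continuous_fst.tendsto' _ _ rfl
        exact this.mono_left nhdsWithin_le_nhds
      · filter_upwards [self_mem_nhdsWithin] with p hp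
        exact hβle _ hp.1 _ hp.2
    · apply ContinuousAt.continuousWithinAt
      have hc : ContinuousAt (fun p : ℝ × ℝ => Real.exp (e.symm (G (Real.log p.1) - p.2))) (s, t) := by
        have hl : ContinuousAt (fun p : ℝ × ℝ => Real.log p.1) (s, t) :=
          continuousAt_fst.log h.ne'
        have h2 : ContinuousAt (fun p : ℝ × ℝ => G (Real.log p.1) - p.2) (s, t) :=
          (ContinuousAt.comp (g := G) hGc.continuousAt hl).sub continuousAt_snd
        exact Real.continuous_exp.continuousAt.comp (hesc.continuousAt.comp h2)
      refine hc.congr ?_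
      have : ∀ᶠ p : ℝ × ℝ in nhds (s, t), 0 < p.1 :=
        continuousAt_fst.eventually_const_lt h
      filter_upwards [this] with p hp
      exact (hβp _ hp _).symm
  refine ⟨β, ⟨hβc, ?_, ?_⟩, ?_⟩
  · intro t ht
    refine ⟨?_, ?_, hβ0 t⟩
    · exact hβc.comp (f := fun s : ℝ => (s, t)) (by fun_prop) (fun s hs => ⟨hs, ht⟩)
    · intro s1 h1 s2 h2 h12
      have hs2 : 0 < s2 := lt_of_le_of_lt h1 h12
      simp only
      rw [hβp s2 hs2]
      rcases (show (0:ℝ) ≤ s1 from h1).eq_or_lt with h | h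
      · rw [← h, hβ0]; positivity
      · rw [hβp s1 h]
        apply Real.exp_lt_exp.2; apply e.symm.strictMono
        have := hGm (Real.log_lt_log h h12)
        linarith
  · intro s hs
    constructor
    · intro t1 _ t2 _ h12
      simp only [hβp s hs]
      apply Real.exp_le_exp.2; apply e.symm.monotone; linarith
    · simp only [hβp s hs]
      refine Real.tendsto_exp_atBot.comp (e.symm.tendsto_atBot.comp ?_)
      exact tendsto_atBot_add_const_left _ _ tendsto_neg_atTop_atBot
  · intro V1 V2 V1' V2' X hX hV1 hV2 hd1 hd2 t ht
    set U : ℝ → ℝ := fun s => max (V1 s) (V2 s) with hU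
    set U' : ℝ → ℝ := fun s => max (if V2 s ≤ V1 s then V1' s else V2' s)
      (if V1 s ≤ V2 s then V2' s else V1' s) with hU'
    have hUc : ∀ s ≥ 0, ContinuousAt U s := fun s hs =>
      (hV1 s hs).continuousAt.max (hV2 s hs).continuousAt
    have hUd : ∀ s ≥ 0, ∀ r, U' s < r → ∃ᶠ z in nhdsWithin s (Ioi s), slope U s z < r := by
      intro s hs r hr
      refine aux_dini (hV1 s hs) (hV2 s hs) ?_ ?_ hr
      · intro h; refine le_trans ?_ (le_max_left _ _); rw [if_pos h]
      · intro h; refine le_trans ?_ (le_max_right _ _); rw [if_pos h]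
    have hUb : ∀ s ≥ 0, X ≤ U s → U' s ≤ - a (U s) := by
      intro s hs hXs
      have p1 : V2 s ≤ V1 s → V1' s ≤ - a (U s) := fun h => by
        have e : U s = V1 s := max_eq_left h
        rw [e] at hXs ⊢; exact hd1 s hs h hXs
      have p2 : V1 s ≤ V2 s → V2' s ≤ - a (U s) := fun h => by
        have e : U s = V2 s := max_eq_right h
        rw [e] at hXs ⊢; exact hd2 s hs h hXs
      apply max_le
      · split_ifs with h
        · exact p1 h
        · exact p2 (le_of_not_ge h)
      · split_ifs with h
        · exact p2 h
        · exact p1 (le_of_not_ge h)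
    change U t ≤ max (β (U 0) t) X
    by_cases hex : ∃ t0 ∈ Icc 0 t, U t0 ≤ X
    · obtain ⟨t0, ht0, hle⟩ := hex
      refine le_max_of_le_right (le_of_forall_pos_le_add fun ε hε => ?_)
      refine image_le_of_liminf_slope_right_lt_deriv_boundary (f := U) (f' := U') (a := t0) (b := t)
        (B := fun _ => X + ε) (B' := fun _ => 0)
        (fun s hs => (hUc s (ht0.1.trans hs.1)).continuousWithinAt)
        (fun s hs => hUd s (ht0.1.trans hs.1)) (by linarith) (fun s => hasDerivAt_const _ _)
        (fun s hs hsX => ?_) ⟨ht0.2, le_rfl⟩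
      have h1 := hUb s (ht0.1.trans hs.1) (by rw [hsX]; linarith)
      have h2 := hapos (U s) (by rw [hsX]; linarith)
      linarith
    · push Not at hex
      refine le_max_of_le_left ?_
      have hU0 : 0 < U 0 := lt_of_le_of_lt hX (hex 0 ⟨le_rfl, ht⟩)
      rw [hβp _ hU0]
      have hk : ∀ k : ℝ, 0 < k → k < 1 →
          U t ≤ Real.exp (e.symm (G (Real.log (U 0)) - k * t)) := by
        intro k hk0 hk1
        set B : ℝ → ℝ := fun s => Real.exp (e.symm (G (Real.log (U 0)) - k * s)) with hB
        have hBd : ∀ s, HasDerivAt B (-k * a (B s)) s := by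
          intro s
          have d1 : HasDerivAt (fun s => G (Real.log (U 0)) - k * s) (-k) s := by
            simpa using ((hasDerivAt_id s).const_mul k).const_sub (G (Real.log (U 0)))
          have d2 := ((hesd (G (Real.log (U 0)) - k * s)).comp s d1).exp
          refine d2.congr_deriv ?_
          simp only [Function.comp, hq, hB, inv_div]
          have := Real.exp_pos (e.symm (G (Real.log (U 0)) - k * s))
          field_simp
        refine image_le_of_liminf_slope_right_lt_deriv_boundary (f := U) (f' := U') (a := 0) (b := t)
          (B := B) (B' := fun s => -k * a (B s))
          (fun s hs => (hUc s hs.1).continuousWithinAt)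
          (fun s hs => hUd s hs.1) ?_ hBd
          (fun s hs hsX => ?_) ⟨ht, le_rfl⟩
        · simp only [hB, mul_zero, sub_zero, hesG, Real.exp_log hU0, le_refl]
        · have h0 := hex s ⟨hs.1, hs.2.le⟩
          have h1 := hUb s hs.1 h0.le
          have h2 := hapos (U s) (by linarith)
          simp only [← hsX]
          nlinarith
      have hlim : Tendsto (fun k : ℝ => Real.exp (e.symm (G (Real.log (U 0)) - k * t)))
          (nhdsWithin 1 (Iio 1)) (nhds (Real.exp (e.symm (G (Real.log (U 0)) - t)))) := by
        have : Continuous (fun k : ℝ => Real.exp (e.symm (G (Real.log (U 0)) - k * t))) := by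
          fun_prop
        exact (this.tendsto' 1 _ (by simp)).mono_left nhdsWithin_le_nhds
      refine ge_of_tendsto hlim ?_
      have : Ioo (0:ℝ) 1 ∈ nhdsWithin (1:ℝ) (Iio 1) := Ioo_mem_nhdsLT (by norm_num)
      filter_upwards [this] with k hk'
      exact hk k hk'.1 hk'.2

theorem ClassK.nonneg {f : ℝ → ℝ} (hf : ClassK f) {r : ℝ} (hr : 0 ≤ r) : 0 ≤ f r := by
  have := hf.2.1.monotoneOn (show (0:ℝ) ∈ Ici 0 from self_mem_Ici) (show r ∈ Ici (0:ℝ) from hr) hr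
  rwa [hf.2.2] at this

theorem ClassK.mono {f : ℝ → ℝ} (hf : ClassK f) {r s : ℝ} (hr : 0 ≤ r) (hrs : r ≤ s) :
    f r ≤ f s :=
  hf.2.1.monotoneOn (show r ∈ Ici (0:ℝ) from hr) (show s ∈ Ici (0:ℝ) from hr.trans hrs) hrs

theorem ClassK.comp' {f g : ℝ → ℝ} (hf : ClassK f) (hg : ClassK g) :
    ClassK (fun r => f (g r)) := by
  have hm : MapsTo g (Ici 0) (Ici 0) := fun r hr => hg.nonneg hr
  exact ⟨hf.1.comp hg.1 hm, hf.2.1.comp hg.2.1 hm, by simp [hg.2.2, hf.2.2]⟩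

theorem ClassK.add' {f g : ℝ → ℝ} (hf : ClassK f) (hg : ClassK g) :
    ClassK (fun r => f r + g r) :=
  ⟨hf.1.add hg.1, hf.2.1.add hg.2.1, by simp [hg.2.2, hf.2.2]⟩

theorem ClassK.const_mul' {f : ℝ → ℝ} (hf : ClassK f) {c : ℝ} (hc : 0 < c) :
    ClassK (fun r => c * f r) :=
  ⟨continuousOn_const.mul hf.1, fun a ha b hb hab => by
    have := hf.2.1 ha hb hab
    simp only; gcongr, by simp [hf.2.2]⟩

theorem classK_id : ClassK (fun r => r) :=
  ⟨continuousOn_id, fun _ _ _ _ h => h, rfl⟩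

theorem classK_sq : ClassK (fun r => r ^ 2) :=
  ⟨by fun_prop, fun a ha b _ h => pow_lt_pow_left₀ h ha (by norm_num), by simp⟩

theorem classK_sqrt : ClassK Real.sqrt :=
  ⟨Real.continuous_sqrt.continuousOn, fun _ ha _ _ h => Real.sqrt_lt_sqrt ha h, by simp⟩

theorem aux_modulus {n m : ℕ} (φ : EuclideanSpace ℝ (Fin n) → EuclideanSpace ℝ (Fin m))
    (hφ : Continuous φ) : ∃ ω : ℝ → ℝ, ClassK ω ∧ ∀ x, ‖φ x - φ 0‖ ≤ ω ‖x‖ := by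
  set K := Metric.closedBall (0 : EuclideanSpace ℝ (Fin n)) 1 with hK
  have hKc : IsCompact K := isCompact_closedBall _ _
  set g : ℝ → EuclideanSpace ℝ (Fin n) → ℝ := fun r y => ‖φ (r • y) - φ 0‖ with hg
  have hgc : Continuous (Function.uncurry g) := by
    simp only [hg, Function.uncurry_def]; fun_prop
  have h0K : (0 : EuclideanSpace ℝ (Fin n)) ∈ K := by simp [hK]
  set h : ℝ → ℝ := fun r => sSup (g r '' K) with hh
  have hhc : Continuous h := hKc.continuous_sSup hgc
  have hbdd : ∀ r, BddAbove (g r '' K) := fun r =>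
    (hKc.image (f := g r) (by simp only [hg]; fun_prop)).bddAbove
  have hle : ∀ r, ∀ y ∈ K, g r y ≤ h r := fun r y hy => le_csSup (hbdd r) ⟨y, hy, rfl⟩
  have hmono : MonotoneOn h (Ici 0) := by
    intro r hr s hs hrs
    refine csSup_le ⟨_, 0, h0K, rfl⟩ ?_
    rintro _ ⟨y, hy, rfl⟩
    rcases (show (0:ℝ) ≤ s from hs).eq_or_lt with h1 | h1
    · have : r = s := le_antisymm hrs (by rw [← h1]; exact hr)
      rw [this]; exact hle s y hy
    · have e : g r y = g s ((r / s) • y) := by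
        simp only [hg, smul_smul]
        rw [mul_div_cancel₀ _ h1.ne']
      rw [e]
      apply hle
      rw [hK, mem_closedBall_zero_iff] at hy ⊢
      have hr' : (0:ℝ) ≤ r := hr
      rw [norm_smul, Real.norm_of_nonneg (by positivity)]
      have : r / s ≤ 1 := (div_le_one h1).2 hrs
      nlinarith [norm_nonneg y, div_nonneg hr' h1.le]
  have hh0 : h 0 = 0 := by
    apply le_antisymm
    · refine csSup_le ⟨_, 0, h0K, rfl⟩ ?_
      rintro _ ⟨y, hy, rfl⟩
      simp [hg]
    · exact le_trans (by simp [hg]) (hle 0 0 h0K)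
  refine ⟨fun r => h r + r, ⟨by fun_prop, ?_, by simp [hh0]⟩, ?_⟩
  · intro r hr s hs hrs
    have := hmono hr hs hrs.le
    simp only; linarith
  · intro x
    have hx : ‖φ x - φ 0‖ ≤ h ‖x‖ := by
      rcases eq_or_ne x 0 with h1 | h1
      · subst h1; simp [hh0]
      · have hx0 : ‖x‖ ≠ 0 := norm_ne_zero_iff.2 h1
        have := hle ‖x‖ (‖x‖⁻¹ • x) (by
          rw [hK, mem_closedBall_zero_iff, norm_smul, norm_inv, norm_norm, inv_mul_cancel₀ hx0])
        simp only [hg, smul_smul, mul_inv_cancel₀ hx0, one_smul] at this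
        exact this
    have := norm_nonneg x
    simp only; linarith

theorem ClassKL.comp' {β : ℝ → ℝ → ℝ} {f g : ℝ → ℝ} (hβ : ClassKL β) (hf : ClassK f)
    (hg : ClassK g) (hg0 : ∀ s > 0, 0 < g s) : ClassKL (fun s t => f (β (g s) t)) := by
  have hnn : ∀ s ≥ 0, ∀ t ≥ 0, 0 ≤ β s t := fun s hs t ht => (hβ.2.1 t ht).nonneg hs
  refine ⟨?_, ?_, ?_⟩
  · have h1 : ContinuousOn (fun p : ℝ × ℝ => (g p.1, p.2)) (Ici 0 ×ˢ Ici 0) :=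
      (hg.1.comp continuousOn_fst fun p hp => hp.1).prodMk continuousOn_snd
    have h2 := hβ.1.comp h1 (fun p hp => ⟨hg.nonneg hp.1, hp.2⟩)
    exact hf.1.comp h2 (fun p hp => hnn _ (hg.nonneg hp.1) _ hp.2)
  · intro t ht
    exact hf.comp' ((hβ.2.1 t ht).comp' hg)
  · intro s hs
    obtain ⟨h1, h2⟩ := hβ.2.2 (g s) (hg0 s hs)
    constructor
    · intro t1 ht1 t2 ht2 h12
      exact hf.mono (hnn _ (hg0 s hs).le _ ht2) (h1 ht1 ht2 h12)
    · have hc : Tendsto f (nhdsWithin 0 (Ici 0)) (nhds 0) := by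
        have := hf.1 0 (show (0:ℝ) ∈ Ici 0 from self_mem_Ici)
        rwa [ContinuousWithinAt, hf.2.2] at this
      refine hc.comp (tendsto_nhdsWithin_iff.2 ⟨h2, ?_⟩)
      filter_upwards [eventually_ge_atTop 0] with t ht
      exact hnn _ (hg0 s hs).le _ ht

theorem ClassK.pos {f : ℝ → ℝ} (hf : ClassK f) {r : ℝ} (hr : 0 < r) : 0 < f r := by
  have := hf.2.1 (show (0:ℝ) ∈ Ici 0 from self_mem_Ici) (show r ∈ Ici (0:ℝ) from hr.le) hr
  rwa [hf.2.2] at this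


theorem aux_lip {E F P : Type*} [NormedAddCommGroup E] [NormedAddCommGroup F]
    [NormedAddCommGroup P] (gs : E → F → P → E) (φ : E → F) {L : NNReal}
    (hL : LipschitzWith L (fun v : E × F × P => gs v.1 v.2.1 v.2.2)) (hφ : LocallyLipschitz φ) :
    LocallyLipschitz (fun x => gs x (φ x) 0) := by
  have hj : LocallyLipschitz (fun x : E => (x, φ x, (0 : P))) :=
    LocallyLipschitz.prodMk (f := fun x => x) LocallyLipschitz.id
      (LocallyLipschitz.prodMk hφ (LocallyLipschitz.const (0 : P)))
  exact LocallyLipschitz.comp hL.locallyLipschitz hj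

theorem aux_diff {E F : Type*} [NormedAddCommGroup E] [NormedAddCommGroup F]
    [NormedSpace ℝ E] [NormedSpace ℝ F] (Vf : F → E → ℝ)
    (hVf : Differentiable ℝ (Function.uncurry Vf)) (z : F) : Differentiable ℝ (Vf z) :=
  Differentiable.comp (g := Function.uncurry Vf) (f := fun x => (z, x)) hVf (by fun_prop)

theorem aux_part {E F : Type*} [NormedAddCommGroup E] [NormedAddCommGroup F]
    [NormedSpace ℝ E] [NormedSpace ℝ F] (Vf : F → E → ℝ)
    (hVfd : Differentiable ℝ (Function.uncurry Vf)) (z : F) (x : E) (a : F) (b : E) :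
      fderiv ℝ (Function.uncurry Vf) (z, x) (a, b) =
        fderiv ℝ (fun z' => Vf z' x) z a + fderiv ℝ (fun x' => Vf z x') x b := by
  have hd := (hVfd (z, x)).hasFDerivAt
  have e1 : HasFDerivAt (fun z' => Vf z' x)
      ((fderiv ℝ (Function.uncurry Vf) (z, x)).comp (ContinuousLinearMap.inl ℝ F E)) z :=
    HasFDerivAt.comp (g := Function.uncurry Vf) (f := fun z => (z, x)) z hd (hasFDerivAt_prodMk_left z x)
  have e2 : HasFDerivAt (fun x' => Vf z x')
      ((fderiv ℝ (Function.uncurry Vf) (z, x)).comp (ContinuousLinearMap.inr ℝ F E)) x :=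
    HasFDerivAt.comp (g := Function.uncurry Vf) (f := fun x => (z, x)) x hd (hasFDerivAt_prodMk_right z x)
  rw [e1.fderiv, e2.fderiv]
  simp only [ContinuousLinearMap.comp_apply, ContinuousLinearMap.inl_apply,
    ContinuousLinearMap.inr_apply, ← map_add, Prod.mk_add_mk, add_zero, zero_add]

set_option maxHeartbeats 1000000 in
/-- **Corollary 1**: under Assumptions 1 and 2, if `g_s`, `γ_s`, `α_f⁻¹` are globally
Lipschitz, `α̲_s`, `α̲_f` are square functions and `λ_f1`, `λ_f2` are square-root
functions, then there exist constant perturbation functions `ρ_s ≡ c_s`, `ρ_f ≡ c_f`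
making the singularly perturbed system ISS with state `(x, z − φ(0))` and
input `(d, w)`. -/
theorem stmt_5
    {n m p q : ℕ}
    (gs : EuclideanSpace ℝ (Fin n) → EuclideanSpace ℝ (Fin m) → EuclideanSpace ℝ (Fin p) →
      EuclideanSpace ℝ (Fin n))
    (gf : EuclideanSpace ℝ (Fin m) → EuclideanSpace ℝ (Fin n) → EuclideanSpace ℝ (Fin q) →
      EuclideanSpace ℝ (Fin m))
    (φ : EuclideanSpace ℝ (Fin n) → EuclideanSpace ℝ (Fin m))
    (Vs : EuclideanSpace ℝ (Fin n) → ℝ)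
    (Vf : EuclideanSpace ℝ (Fin m) → EuclideanSpace ℝ (Fin n) → ℝ)
    (αsLo αsHi γs χs αfLo αfHi χf αs αf lf1 lf2 : ℝ → ℝ)
    -- regularity of the system
    (hlip_s : ∀ d, LocallyLipschitz
      (fun xz : EuclideanSpace ℝ (Fin n) × EuclideanSpace ℝ (Fin m) => gs xz.1 xz.2 d))
    (hlip_f : ∀ w, LocallyLipschitz
      (fun xz : EuclideanSpace ℝ (Fin n) × EuclideanSpace ℝ (Fin m) => gf xz.2 xz.1 w))
    -- Assumption 1
    (hφ : LocallyLipschitz φ)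
    (hgs0 : gs 0 (φ 0) 0 = 0) (hgf0 : ∀ x, gf (φ x) x 0 = 0)
    -- Assumption 2
    (hVs : ContDiff ℝ 1 Vs) (hVf : ContDiff ℝ 1 (Function.uncurry Vf))
    (hαsLo : ClassKInf αsLo) (hαsHi : ClassKInf αsHi) (hγs : ClassKInf γs)
    (hχs : ClassKInf χs) (hαfLo : ClassKInf αfLo) (hαfHi : ClassKInf αfHi)
    (hχf : ClassKInf χf)
    (hαs : ClassPD αs) (hαf : ClassPD αf) (hlf1 : ClassPD lf1) (hlf2 : ClassPD lf2)
    (hVs_bnd : ∀ x, αsLo ‖x‖ ≤ Vs x ∧ Vs x ≤ αsHi ‖x‖)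
    (hVs_dec : ∀ x z d, max (γs (Vf z x)) (χs ‖d‖) ≤ Vs x →
      fderiv ℝ Vs x (gs x z d) ≤ -αs (Vs x))
    (hVf_bnd : ∀ z x, αfLo ‖z - φ x‖ ≤ Vf z x ∧ Vf z x ≤ αfHi ‖z - φ x‖)
    (hVf_dec : ∀ z x w, χf ‖w‖ ≤ Vf z x →
      fderiv ℝ (fun z' => Vf z' x) z (gf z x w) ≤ -αf (Vf z x))
    (hVf_cross : ∀ z x, ‖fderiv ℝ (fun x' => Vf z x') x‖ ≤ lf1 (Vf z x) + lf2 (Vs x))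
    -- additional conditions of Corollary 1
    (hgsLip : ∃ L : NNReal, LipschitzWith L
      (fun v : EuclideanSpace ℝ (Fin n) × EuclideanSpace ℝ (Fin m) × EuclideanSpace ℝ (Fin p) =>
        gs v.1 v.2.1 v.2.2))
    (hγsLip : ∃ L : NNReal, LipschitzOnWith L γs (Ici 0))
    (hαfKInf : ClassKInf αf)
    (αfInv : ℝ → ℝ) (hαfInv : ∀ r ≥ 0, αfInv (αf r) = r ∧ αf (αfInv r) = r)
    (hαfInvLip : ∃ L : NNReal, LipschitzOnWith L αfInv (Ici 0))
    (aS aF b1 b2 : ℝ) (haS : 0 < aS) (haF : 0 < aF) (hb1 : 0 < b1) (hb2 : 0 < b2)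
    (hαsLo_sq : ∀ r ≥ 0, αsLo r = aS * r ^ 2)
    (hαfLo_sq : ∀ r ≥ 0, αfLo r = aF * r ^ 2)
    (hlf1_sqrt : ∀ r ≥ 0, lf1 r = b1 * Real.sqrt r)
    (hlf2_sqrt : ∀ r ≥ 0, lf2 r = b2 * Real.sqrt r) :
    -- conclusion: there exist constants c_s, c_f > 0 such that the system with
    -- ρ_s ≡ c_s and ρ_f ≡ c_f is ISS with state (x, z − φ(0)) and input (d, w)
    ∃ cs cf : ℝ, 0 < cs ∧ 0 < cf ∧
      ∃ β : ℝ → ℝ → ℝ, ∃ χ : ℝ → ℝ, ClassKL β ∧ ClassK χ ∧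
      ∀ (x : ℝ → EuclideanSpace ℝ (Fin n)) (z : ℝ → EuclideanSpace ℝ (Fin m))
        (d : ℝ → EuclideanSpace ℝ (Fin p)) (w : ℝ → EuclideanSpace ℝ (Fin q)),
        (∀ t ≥ 0, HasDerivAt x (cs • gs (x t) (z t) (d t)) t) →
        (∀ t ≥ 0, HasDerivAt z (cf • gf (z t) (x t) (w t)) t) →
        ∀ D ≥ 0, (∀ t ≥ 0, ‖d t‖ ≤ D ∧ ‖w t‖ ≤ D) →
        ∀ t ≥ 0, ‖(x t, z t - φ 0)‖ ≤ max (β ‖(x 0, z 0 - φ 0)‖ t) (χ D) := by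
  obtain ⟨L0, hL0⟩ := hgsLip
  obtain ⟨Lγ, hLγ⟩ := hγsLip
  obtain ⟨Li, hLi⟩ := hαfInvLip
  set L : ℝ := (L0 : ℝ) with hL
  have hLnn : 0 ≤ L := L0.2
  have hgsL : ∀ x z d x' z' d', ‖gs x z d - gs x' z' d'‖ ≤
      L * (‖x - x'‖ + ‖z - z'‖ + ‖d - d'‖) := by
    intro x z d x' z' d'
    have h := hL0.norm_sub_le (x, z, d) (x', z', d')
    refine h.trans ?_
    gcongr
    simp only [Prod.mk_sub_mk, Prod.norm_mk]
    have h1 := norm_nonneg (x - x')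
    have h2 := norm_nonneg (z - z')
    have h3 := norm_nonneg (d - d')
    refine max_le (by linarith) (max_le (by linarith) (by linarith))
  have hVsd : Differentiable ℝ Vs := hVs.differentiable (by norm_num)
  have hVfd : Differentiable ℝ (Function.uncurry Vf) := hVf.differentiable (by norm_num)
  have hVsb : ∀ x, aS * ‖x‖ ^ 2 ≤ Vs x := fun x => by
    rw [← hαsLo_sq _ (norm_nonneg x)]; exact (hVs_bnd x).1
  have hVfb : ∀ z x, aF * ‖z - φ x‖ ^ 2 ≤ Vf z x := fun z x => by
    rw [← hαfLo_sq _ (norm_nonneg _)]; exact (hVf_bnd z x).1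
  have hVs0 : ∀ x, 0 ≤ Vs x := fun x => le_trans (by positivity) (hVsb x)
  have hVf0 : ∀ z x, 0 ≤ Vf z x := fun z x => le_trans (by positivity) (hVfb z x)
  have hVfz : ∀ x, Vf (φ x) x = 0 := fun x => by
    have := (hVf_bnd (φ x) x).2
    rw [sub_self, norm_zero, hαfHi.1.2.2] at this
    exact le_antisymm this (hVf0 _ _)
  have hcross : ∀ z x, ‖fderiv ℝ (Vf z) x‖ ≤ b1 * √(Vf z x) + b2 * √(Vs x) := fun z x => by
    have := hVf_cross z x
    rwa [hlf1_sqrt _ (hVf0 z x), hlf2_sqrt _ (hVs0 x)] at this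
  have hfl : LocallyLipschitz (fun x => gs x (φ x) 0) := aux_lip gs φ hL0 hφ
  have hfL : ∀ x y, ‖gs x (φ x) 0 - gs y (φ y) 0‖ ≤ L * (‖x - y‖ + ‖φ x - φ y‖) := by
    intro x y
    have h := hgsL x (φ x) 0 y (φ y) 0
    rwa [sub_self, norm_zero, add_zero] at h
  have hVfz' : ∀ z, Differentiable ℝ (Vf z) := fun z => aux_diff Vf hVfd z
  -- key estimate
  obtain ⟨C, hC0, hC⟩ := aux_key (fun x => gs x (φ x) 0) φ Vs Vf aS aF b1 b2 L haS haF hb1 hb2 hLnn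
    hfl hfL hVsd hVfz'
    hVsb
    (fun x => by
      have := hVs_dec x (φ x) 0 (by
        rw [hVfz, hγs.1.2.2, norm_zero, hχs.1.2.2, max_self]; exact hVs0 x)
      have h2 : 0 ≤ αs (Vs x) := by
        rcases (hVs0 x).eq_or_lt with h | h
        · rw [← h, hαs.2.2]
        · exact (hαs.2.1 _ h).le
      linarith)
    hVfb hVfz hcross
  have hgsb : ∀ x z d, ‖gs x z d‖ ≤ C * √(Vs x) + L * (‖z - φ x‖ + ‖d‖) := by
    intro x z d
    have h1 := hgsL x z d x (φ x) 0
    have h2 := hC x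
    have h3 := norm_sub_norm_le (gs x z d) (gs x (φ x) 0)
    simp only [sub_self, norm_zero, sub_zero, zero_add] at h1
    linarith
  -- gain of γs
  set μ : ℝ := (Lγ : ℝ) + 1 with hμ
  have hμ0 : 0 < μ := by have := Lγ.2; positivity
  have hγμ : ∀ r ≥ 0, γs r ≤ μ * r := by
    intro r hr
    have := hLγ.norm_sub_le (show r ∈ Ici (0:ℝ) from hr) (show (0:ℝ) ∈ Ici 0 from self_mem_Ici)
    rw [hγs.1.2.2, sub_zero, sub_zero, Real.norm_of_nonneg hr] at this
    have h2 := (le_abs_self _).trans this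
    rw [hμ]; linarith
  set Λ : ℝ := (Li : ℝ) + 1 with hΛ
  have hΛ0 : 0 < Λ := by have := Li.2; positivity
  have hαfl : ∀ r ≥ 0, r ≤ Λ * αf r := by
    intro r hr
    have h0 : 0 ≤ αf r := hαfKInf.1.nonneg hr
    have := hLi.norm_sub_le (show αf r ∈ Ici (0:ℝ) from h0) (show αf 0 ∈ Ici (0:ℝ) from hαf.2.2.ge)
    rw [(hαfInv r hr).1, (hαfInv 0 le_rfl).1, hαf.2.2, sub_zero, sub_zero,
      Real.norm_of_nonneg hr, Real.norm_of_nonneg h0] at this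
    rw [hΛ]; linarith
  set K : ℝ := (b1 + b2 * √μ) * (C * √μ + L * ((√aF)⁻¹ + 1)) with hK
  have hK0 : 0 ≤ K := by positivity
  have hcf : 0 < (K + 1) * Λ := by positivity
  obtain ⟨ω, hω, hφω⟩ := aux_modulus φ hφ.continuous
  obtain ⟨βh, hβh, hcomp⟩ := aux_KL αs hαs.1 hαs.2.1
  set η1 : ℝ → ℝ := fun s => ω (√(aS⁻¹ * s)) + (√(aS⁻¹ * s) + √((μ * aF)⁻¹ * s)) with hη1
  have hq1 : ClassK (fun s => √(aS⁻¹ * s)) :=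
    classK_sqrt.comp' (classK_id.const_mul' (inv_pos.2 haS))
  have hq2 : ClassK (fun s => √((μ * aF)⁻¹ * s)) :=
    classK_sqrt.comp' (classK_id.const_mul' (inv_pos.2 (mul_pos hμ0 haF)))
  have hη1K : ClassK η1 := (hω.comp' hq1).add' (hq1.add' hq2)
  set η2 : ℝ → ℝ := fun r => αsHi r + μ * αfHi (r + ω r) with hη2
  have hη2K : ClassK η2 :=
    hαsHi.1.add' ((hαfHi.1.comp' (classK_id.add' hω)).const_mul' hμ0)
  set X : ℝ → ℝ := fun D => χs D + μ * (χf D + D ^ 2) with hX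
  have hXK : ClassK X := hχs.1.add' ((hχf.1.add' classK_sq).const_mul' hμ0)
  refine ⟨1, (K + 1) * Λ, one_pos, hcf, fun s t => η1 (βh (η2 s) t), fun D => η1 (X D),
    hβh.comp' hη1K hη2K (fun s hs => hη2K.pos hs), hη1K.comp' hXK, ?_⟩
  intro x z d w hx hz D hD hdw t ht
  set V1 : ℝ → ℝ := fun t => Vs (x t) with hV1
  set V2 : ℝ → ℝ := fun t => μ * Vf (z t) (x t) with hV2
  have hpart : ∀ z x (a : EuclideanSpace ℝ (Fin m)) (b : EuclideanSpace ℝ (Fin n)),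
      fderiv ℝ (Function.uncurry Vf) (z, x) (a, b) =
        fderiv ℝ (fun z' => Vf z' x) z a + fderiv ℝ (fun x' => Vf z x') x b := by
    exact aux_part Vf hVfd
  have hx' : ∀ t ≥ 0, HasDerivAt x (gs (x t) (z t) (d t)) t := fun t ht => by
    simpa using hx t ht
  have hd1 : ∀ t ≥ 0, HasDerivAt V1 (fderiv ℝ Vs (x t) (gs (x t) (z t) (d t))) t := fun t ht =>
    (hVsd (x t)).hasFDerivAt.comp_hasDerivAt t (hx' t ht)
  have hd2 : ∀ t ≥ 0, HasDerivAt V2 (μ * (fderiv ℝ (Function.uncurry Vf) (z t, x t)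
      (((K + 1) * Λ) • gf (z t) (x t) (w t), gs (x t) (z t) (d t)))) t := fun t ht =>
    ((hVfd (z t, x t)).hasFDerivAt.comp_hasDerivAt (f := fun t => (z t, x t)) t
      ((hz t ht).prodMk (hx' t ht))).const_mul μ
  have hXs : χs D ≤ X D := by
    have := hχf.1.nonneg hD
    have : 0 ≤ μ * (χf D + D ^ 2) := by positivity
    simp only [hX]; linarith
  have hXf : μ * (χf D + D ^ 2) ≤ X D := by
    have := hχs.1.nonneg hD
    simp only [hX]; linarith
  have main := hcomp V1 V2 _ _ (X D) (hXK.nonneg hD) hd1 hd2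
    (by
      intro t ht h21 hXt
      refine (hVs_dec (x t) (z t) (d t) (max_le ?_ ?_)).trans (neg_le_neg (min_le_left _ _))
      · exact (hγμ _ (hVf0 _ _)).trans h21
      · exact (hχs.1.mono (norm_nonneg _) (hdw t ht).1).trans (hXs.trans hXt))
    (by
      intro t ht h12 hXt
      set F := Vf (z t) (x t) with hF
      have hF0 : 0 ≤ F := hVf0 _ _
      refine le_trans ?_ (neg_le_neg (min_le_right _ _))
      change _ ≤ -(μ * F)
      have hFX : χf D + D ^ 2 ≤ F := le_of_mul_le_mul_left (hXf.trans hXt) hμ0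
      have hχD := hχf.1.nonneg hD
      have hFw : χf ‖w t‖ ≤ F := by
        have := hχf.1.mono (norm_nonneg _) (hdw t ht).2
        have := sq_nonneg D
        linarith
      have hdF : ‖d t‖ ≤ √F :=
        (hdw t ht).1.trans (Real.le_sqrt_of_sq_le (by linarith))
      have hVsF : √(Vs (x t)) ≤ √μ * √F := by
        rw [← Real.sqrt_mul hμ0.le]; exact Real.sqrt_le_sqrt h12
      have heF : ‖z t - φ (x t)‖ ≤ (√aF)⁻¹ * √F := by
        rw [← div_eq_inv_mul, le_div_iff₀ (by positivity)]
        apply Real.le_sqrt_of_sq_le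
        rw [mul_pow, Real.sq_sqrt haF.le]
        linarith [hVfb (z t) (x t)]
      have h1 := hVf_dec (z t) (x t) (w t) hFw
      rw [← hF] at h1
      have h2 : fderiv ℝ (fun x' => Vf (z t) x') (x t) (gs (x t) (z t) (d t)) ≤ K * F := by
        have k1 : ‖fderiv ℝ (Vf (z t)) (x t)‖ ≤ (b1 + b2 * √μ) * √F := by
          refine (hcross (z t) (x t)).trans ?_
          have : b2 * √(Vs (x t)) ≤ b2 * (√μ * √F) := by gcongr
          rw [← hF]; linarith
        have k2 : ‖gs (x t) (z t) (d t)‖ ≤ (C * √μ + L * ((√aF)⁻¹ + 1)) * √F := by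
          refine (hgsb _ _ _).trans ?_
          calc _ ≤ C * (√μ * √F) + L * ((√aF)⁻¹ * √F + √F) := by gcongr
            _ = _ := by ring
        refine (le_abs_self _).trans (((fderiv ℝ (Vf (z t)) (x t)).le_opNorm _).trans ?_)
        calc _ ≤ ((b1 + b2 * √μ) * √F) * ((C * √μ + L * ((√aF)⁻¹ + 1)) * √F) := by gcongr
          _ = K * (√F * √F) := by rw [hK]; ring
          _ = K * F := by rw [Real.mul_self_sqrt hF0]
      rw [hpart, map_smul, smul_eq_mul]
      have h3 := hαfl F hF0
      have h4 : (K + 1) * Λ * fderiv ℝ (fun z' => Vf z' (x t)) (z t) (gf (z t) (x t) (w t))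
          ≤ -((K + 1) * F) := by
        have : (K + 1) * Λ * fderiv ℝ (fun z' => Vf z' (x t)) (z t) (gf (z t) (x t) (w t))
          ≤ (K + 1) * Λ * (-αf F) := by gcongr
        have : (K + 1) * F ≤ (K + 1) * (Λ * αf F) := by gcongr
        linarith
      rw [← mul_neg]
      gcongr
      linarith)
    t ht
  -- convert
  have hlow : ‖(x t, z t - φ 0)‖ ≤ η1 (max (V1 t) (V2 t)) := by
    set U := max (V1 t) (V2 t) with hU
    have hU0 : 0 ≤ U := le_max_of_le_left (hVs0 _)
    have p1 : ‖x t‖ ≤ √(aS⁻¹ * U) := by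
      apply Real.le_sqrt_of_sq_le
      rw [← div_eq_inv_mul, le_div_iff₀ haS]
      have := hVsb (x t)
      have : V1 t ≤ U := le_max_left _ _
      simp only [hV1] at this
      linarith
    have p2 : ‖z t - φ (x t)‖ ≤ √((μ * aF)⁻¹ * U) := by
      apply Real.le_sqrt_of_sq_le
      rw [← div_eq_inv_mul, le_div_iff₀ (by positivity)]
      have h1 : μ * (aF * ‖z t - φ (x t)‖ ^ 2) ≤ μ * Vf (z t) (x t) := by
        gcongr; exact hVfb (z t) (x t)
      have : V2 t ≤ U := le_max_right _ _
      simp only [hV2] at this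
      linarith
    have p3 : ‖φ (x t) - φ 0‖ ≤ ω (√(aS⁻¹ * U)) :=
      (hφω _).trans (hω.mono (norm_nonneg _) p1)
    have p4 : ‖z t - φ 0‖ ≤ ‖z t - φ (x t)‖ + ‖φ (x t) - φ 0‖ := norm_sub_le_norm_sub_add_norm_sub _ _ _
    have q1 := norm_nonneg (x t)
    have q2 := norm_nonneg (z t - φ (x t))
    have q3 := norm_nonneg (φ (x t) - φ 0)
    rw [Prod.norm_mk]
    simp only [hη1]
    refine max_le ?_ ?_ <;> linarith
  have hup : max (V1 0) (V2 0) ≤ η2 ‖(x 0, z 0 - φ 0)‖ := by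
    set r := ‖(x 0, z 0 - φ 0)‖ with hr
    have hr0 : 0 ≤ r := norm_nonneg _
    have r1 : ‖x 0‖ ≤ r := norm_fst_le (x 0, z 0 - φ 0)
    have r2 : ‖z 0 - φ 0‖ ≤ r := norm_snd_le (x 0, z 0 - φ 0)
    have r3 : ‖z 0 - φ (x 0)‖ ≤ r + ω r := by
      have e1 : ‖z 0 - φ (x 0)‖ ≤ ‖z 0 - φ 0‖ + ‖φ 0 - φ (x 0)‖ :=
        norm_sub_le_norm_sub_add_norm_sub _ _ _
      rw [norm_sub_rev (φ 0)] at e1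
      have e2 := (hφω (x 0)).trans (hω.mono (norm_nonneg _) r1)
      linarith
    have s1 : V1 0 ≤ αsHi r := (hVs_bnd _).2.trans (hαsHi.1.mono (norm_nonneg _) r1)
    have s2 : V2 0 ≤ μ * αfHi (r + ω r) := by
      simp only [hV2]
      gcongr
      exact (hVf_bnd _ _).2.trans (hαfHi.1.mono (norm_nonneg _) r3)
    have t1 := hαsHi.1.nonneg hr0
    have t2 : 0 ≤ μ * αfHi (r + ω r) :=
      mul_nonneg hμ0.le (hαfHi.1.nonneg (add_nonneg hr0 (hω.nonneg hr0)))
    simp only [hη2]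
    refine max_le ?_ ?_ <;> linarith
  have hU00 : 0 ≤ max (V1 0) (V2 0) := le_max_of_le_left (hVs0 _)
  have hUt0 : 0 ≤ max (V1 t) (V2 t) := le_max_of_le_left (hVs0 _)
  have hβmono : βh (max (V1 0) (V2 0)) t ≤ βh (η2 ‖(x 0, z 0 - φ 0)‖) t :=
    (hβh.2.1 t ht).mono hU00 hup
  refine hlow.trans ?_
  rcases le_max_iff.1 main with h | h
  · exact le_max_of_le_left (hη1K.mono hUt0 (h.trans hβmono))
  · exact le_max_of_le_right (hη1K.mono hUt0 h)
end
end

section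
/- Let h_f^o : ℝᵐ → ℝⁿ be globally Lipschitz with constant L, let φ^o : ℝⁿ → ℝᵐ, and suppose there exist x_e ∈ ℝⁿ and c > 0 such that h_f^o(φ^o(x_e)) = 0 and (x−x_e)ᵀ h_f^o(φ^o(x)) ≥ c|x−x_e|² for all x ∈ ℝⁿ. Then the condition of Assumption 3 holds: there exist φ₁ of class K∞ and φ₂ of class PD (for instance φ₁(r) = (2L/c)r and φ₂(r) = (c/2)r²) such that for all x ∈ ℝⁿ and δ ∈ ℝᵐ, |x−x_e| ≥ φ₁(|δ|) implies (x−x_e)ᵀ h_f^o(φ^o(x)+δ) ≥ φ₂(|x−x_e|). -/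
open Set Filter MeasureTheory InnerProductSpace

noncomputable section

/-- If `h_f^o` is globally Lipschitz with constant `L` and the steady-state
input-output map satisfies the strong monotonicity condition
`(x−x_e)ᵀ h_f^o(φ^o(x)) ≥ c|x−x_e|²`, then the condition of Assumption 3 holds. -/
theorem stmt_10
    {n m : ℕ}
    (hfo : EuclideanSpace ℝ (Fin m) → EuclideanSpace ℝ (Fin n))
    (φo : EuclideanSpace ℝ (Fin n) → EuclideanSpace ℝ (Fin m))
    (L : ℝ) (hL : 0 < L)
    (hlip : ∀ z₁ z₂, ‖hfo z₁ - hfo z₂‖ ≤ L * ‖z₁ - z₂‖)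
    (xe : EuclideanSpace ℝ (Fin n)) (c : ℝ) (hc : 0 < c)
    (hxe : hfo (φo xe) = 0)
    (hmono : ∀ x, c * ‖x - xe‖ ^ 2 ≤ ⟪x - xe, hfo (φo x)⟫_ℝ) :
    ∃ φ₁ φ₂ : ℝ → ℝ, ClassKInf φ₁ ∧ ClassPD φ₂ ∧
      ∀ (x : EuclideanSpace ℝ (Fin n)) (δ : EuclideanSpace ℝ (Fin m)),
        φ₁ ‖δ‖ ≤ ‖x - xe‖ → φ₂ ‖x - xe‖ ≤ ⟪x - xe, hfo (φo x + δ)⟫_ℝ := by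
  have hk : 0 < 2 * L / c := by positivity
  refine ⟨fun r => 2 * L / c * r, fun r => c / 2 * r ^ 2, ⟨⟨?_, ?_, ?_⟩, ?_⟩, ⟨?_, ?_, ?_⟩, ?_⟩
  · fun_prop
  · intro a _ b _ hab
    exact mul_lt_mul_of_pos_left hab hk
  · simp
  · intro M
    refine ⟨(|M| + 1) / (2 * L / c), ?_, ?_⟩
    · simp only [mem_Ici]
      positivity
    · show M < 2 * L / c * ((|M| + 1) / (2 * L / c))
      rw [mul_div_cancel₀ _ hk.ne']
      linarith [le_abs_self M]
  · fun_prop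
  · intro r hr
    positivity
  · simp
  · intro x δ h
    have h1 : L * ‖δ‖ ≤ c / 2 * ‖x - xe‖ := by
      have h2 := mul_le_mul_of_nonneg_left h (by positivity : 0 ≤ c / 2)
      have h3 : c / 2 * (2 * L / c * ‖δ‖) = L * ‖δ‖ := by field_simp
      simp only [] at h2
      linarith
    have h4 : ‖hfo (φo x + δ) - hfo (φo x)‖ ≤ L * ‖δ‖ := by
      simpa using hlip (φo x + δ) (φo x)
    have h5 := (abs_le.mp (abs_real_inner_le_norm (x - xe) (hfo (φo x + δ) - hfo (φo x)))).1
    rw [inner_sub_right] at h5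
    have h6 := mul_le_mul_of_nonneg_left (h4.trans h1) (norm_nonneg (x - xe))
    have h7 := hmono x
    show c / 2 * ‖x - xe‖ ^ 2 ≤ _
    nlinarith
end
end
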